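/- arXiv:2209.00212 — 3 statements merged into one kernel-verified Lean document; each statement's English description precedes it below -/
import Mathlib

section
/- For every integer i ≥ 1, the i-th smallest positive zero j_i of the Bessel function J₁ satisfies iπ < j_i < (i + 1/2)π. -/
/-- The Bessel function of the first kind of order 0. -/
noncomputable def besselJ0 (x : ℝ) : ℝ :=
  ∑' k : ℕ, (-1 : ℝ) ^ k * (x / 2) ^ (2 * k) / ((k.factorial : ℝ)) ^ 2

/-- The Bessel function of the first kind of order 1. -/
noncomputable def besselJ1 (x : ℝ) : ℝ :=
  ∑' k : ℕ, (-1 : ℝ) ^ k * (x / 2) ^ (2 * k + 1) /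
    ((k.factorial : ℝ) * ((k + 1).factorial : ℝ))

namespace BZ

open Set Filter Topology

lemma hasDeriv_series (c : ℕ → ℝ) (hc : ∀ k, |c k| ≤ 1 / (k.factorial : ℝ)) (t : ℝ) :
    HasDerivAt (fun t => ∑' k, c k * t ^ k) (∑' k, c (k+1) * (k+1) * t ^ k) t := by
  set R : ℝ := |t| + 1 with hR
  have hR0 : 0 ≤ R := by positivity
  have hu : Summable (fun k : ℕ => (k : ℝ) * R ^ (k - 1) / (k.factorial : ℝ)) := by
    rw [← summable_nat_add_iff 1]
    refine (Real.summable_pow_div_factorial R).congr ?_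
    intro k
    rw [Nat.factorial_succ]
    have : (k.factorial : ℝ) ≠ 0 := by positivity
    push_cast
    field_simp
  have hb : ∀ (k : ℕ) (y : ℝ), y ∈ Metric.ball (0:ℝ) R →
      ‖c k * ((k : ℝ) * y ^ (k - 1))‖ ≤ (k : ℝ) * R ^ (k - 1) / (k.factorial : ℝ) := by
    intro k y hy
    have hy' : |y| ≤ R := by simpa using (mem_ball_zero_iff.1 hy).le
    rw [norm_mul, norm_mul, norm_pow, Real.norm_eq_abs, Real.norm_eq_abs, Real.norm_eq_abs,
      Nat.abs_cast]
    calc |c k| * ((k : ℝ) * |y| ^ (k-1)) ≤ (1 / (k.factorial : ℝ)) * ((k : ℝ) * R ^ (k-1)) := by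
          gcongr
          exact hc k
      _ = _ := by ring
  have ht : t ∈ Metric.ball (0:ℝ) R := by
    rw [mem_ball_zero_iff, Real.norm_eq_abs]; linarith
  have key := hasDerivAt_tsum_of_isPreconnected (g := fun k t => c k * t ^ k)
    (g' := fun k t => c k * ((k : ℝ) * t ^ (k - 1))) (y₀ := t) (y := t) hu Metric.isOpen_ball
    (convex_ball (0:ℝ) R).isPreconnected
    (fun k y _ => (hasDerivAt_pow k y).const_mul (c k)) hb ht
    (by
      refine Summable.of_norm_bounded (Real.summable_pow_div_factorial R) ?_
      intro k
      have hy' : |t| ≤ R := by linarith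
      rw [norm_mul, norm_pow, Real.norm_eq_abs, Real.norm_eq_abs]
      calc |c k| * |t| ^ k ≤ (1 / (k.factorial : ℝ)) * R ^ k := by
            gcongr
            exact hc k
        _ = _ := by ring) ht
  have hs : Summable (fun k => c k * ((k : ℝ) * t ^ (k - 1))) :=
    Summable.of_norm_bounded hu (fun k => hb k t ht)
  rw [hs.tsum_eq_zero_add] at key
  refine key.congr_deriv ?_
  symm
  simp only [CharP.cast_eq_zero, zero_mul, mul_zero, zero_add]
  refine tsum_congr fun k => ?_
  rw [Nat.add_sub_cancel]
  push_cast
  ring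

noncomputable def F0 (t : ℝ) : ℝ := ∑' k : ℕ, ((-1 : ℝ) ^ k / ((k.factorial : ℝ)) ^ 2) * t ^ k
noncomputable def F1 (t : ℝ) : ℝ :=
  ∑' k : ℕ, ((-1 : ℝ) ^ k / ((k.factorial : ℝ) * ((k+1).factorial : ℝ))) * t ^ k

lemma one_le_fac (k : ℕ) : (1:ℝ) ≤ (k.factorial : ℝ) := by
  exact_mod_cast Nat.one_le_iff_ne_zero.2 (Nat.factorial_ne_zero k)

lemma bound_aux (k : ℕ) (a b : ℝ) (ha : (k.factorial : ℝ) ≤ a) (hb : 1 ≤ b) :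
    |(-1 : ℝ) ^ k / (a * b)| ≤ 1 / (k.factorial : ℝ) := by
  have h1 := one_le_fac k
  have : (k.factorial : ℝ) ≤ a * b := by nlinarith
  rw [abs_div, abs_pow, abs_neg, abs_one, one_pow, abs_of_nonneg (by linarith)]
  gcongr

lemma F0_deriv (t : ℝ) : HasDerivAt F0 (-F1 t) t := by
  have := hasDeriv_series (fun k => (-1 : ℝ) ^ k / ((k.factorial : ℝ)) ^ 2) (fun k => by
    simp only [pow_two (k.factorial : ℝ)]
    exact bound_aux k _ _ le_rfl (one_le_fac k)) t
  refine HasDerivAt.congr_deriv this ?_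
  symm
  rw [F1, ← tsum_neg]
  refine tsum_congr fun k => ?_
  rw [Nat.factorial_succ]
  have : (k.factorial : ℝ) ≠ 0 := by positivity
  have : (k + 1 : ℝ) ≠ 0 := by positivity
  push_cast
  field_simp
  ring

lemma F1_cont : Continuous F1 := by
  rw [continuous_iff_continuousAt]
  intro t
  exact (hasDeriv_series (fun k => (-1 : ℝ) ^ k / ((k.factorial : ℝ) * ((k+1).factorial : ℝ)))
    (fun k => bound_aux k _ _ le_rfl (one_le_fac (k+1))) t).continuousAt

lemma tF1_deriv (t : ℝ) : HasDerivAt (fun t => t * F1 t) (F0 t) t := by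
  have := hasDeriv_series (fun k => if k = 0 then 0 else
      -(-1 : ℝ) ^ k / ((k.factorial : ℝ) * ((k-1).factorial : ℝ)))
    (fun k => by
      by_cases hk : k = 0
      · simp [hk]
      · simp only [hk, if_false, neg_div, abs_neg]
        exact bound_aux k _ _ le_rfl (one_le_fac (k-1))) t
  convert this using 1
  · funext s
    rw [F1, ← tsum_mul_left]
    symm
    rw [← Function.Injective.tsum_eq (f := fun k : ℕ => (if k = 0 then 0 else
      -(-1 : ℝ) ^ k / ((k.factorial : ℝ) * ((k-1).factorial : ℝ))) * s ^ k) (add_left_injective 1)]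
    · refine tsum_congr fun k => ?_
      simp only [Nat.add_eq_zero_iff, one_ne_zero, and_false, if_false, Nat.add_sub_cancel]
      ring
    · intro k hk
      rcases k with _ | k
      · simp at hk
      · exact ⟨k, rfl⟩
  · rw [F0]
    refine tsum_congr fun k => ?_
    simp only [Nat.add_eq_zero_iff, one_ne_zero, and_false, if_false, Nat.add_sub_cancel]
    rw [Nat.factorial_succ]
    have : (k.factorial : ℝ) ≠ 0 := by positivity
    have : (k + 1 : ℝ) ≠ 0 := by positivity
    push_cast
    field_simp
    ring

noncomputable def A (x : ℝ) : ℝ := F0 (x^2/4)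
noncomputable def h (x : ℝ) : ℝ := F1 (x^2/4) / 2

lemma J1_eq (x : ℝ) : besselJ1 x = x * h x := by
  rw [besselJ1, h, F1, ← tsum_div_const, ← tsum_mul_left]
  refine tsum_congr fun k => ?_
  have : x^2/4 = (x/2)^2 := by ring
  rw [this, ← pow_mul, pow_succ]
  ring

lemma sq_deriv (x : ℝ) : HasDerivAt (fun x : ℝ => x^2/4) (x/2) x := by
  have := (hasDerivAt_pow 2 x).div_const 4
  refine this.congr_deriv ?_
  norm_num; ring

lemma A_deriv (x : ℝ) : HasDerivAt A (-(x * h x)) x := by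
  have := (F0_deriv (x^2/4)).comp x (sq_deriv x)
  refine HasDerivAt.congr_deriv this ?_
  rw [h]; ring

lemma h_cont : Continuous h := by
  unfold h
  exact (F1_cont.comp (by fun_prop)).div_const 2

lemma A_cont : Continuous A := continuous_iff_continuousAt.2 fun x => (A_deriv x).continuousAt

lemma h_deriv (x : ℝ) (hx : 0 < x) : HasDerivAt h ((A x - 2 * h x) / x) x := by
  have h1 := (tF1_deriv (x^2/4)).comp x (sq_deriv x)
  have h2 := h1.div ((hasDerivAt_pow 2 x).div_const 2) (by positivity)
  have h3 : HasDerivAt h _ x := h2.congr_of_eventuallyEq (by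
    filter_upwards [lt_mem_nhds hx] with y hy
    simp only [h, Pi.div_apply, Function.comp]
    field_simp
    ring)
  refine h3.congr_deriv ?_
  simp only [Function.comp, A, h]
  field_simp
  norm_num
  ring

lemma lt_of_deriv_neg {W D : ℝ → ℝ} {a b : ℝ} (hab : a < b) (hc : Continuous W)
    (hd : ∀ x ∈ Ioo a b, HasDerivAt W (D x) x) (hD : ∀ x ∈ Ioo a b, D x < 0) : W b < W a := by
  refine strictAntiOn_of_deriv_neg (convex_Icc a b) hc.continuousOn ?_
    (left_mem_Icc.2 hab.le) (right_mem_Icc.2 hab.le) hab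
  intro x hx
  rw [interior_Icc] at hx
  rw [(hd x hx).deriv]
  exact hD x hx

lemma deriv_nonpos_right {f : ℝ → ℝ} {f' a b : ℝ} (hab : a < b) (hf : HasDerivAt f f' b)
    (hb : f b = 0) (hpos : ∀ x ∈ Ioo a b, 0 < f x) : f' ≤ 0 := by
  have h1 := (hasDerivWithinAt_iff_tendsto_slope' (by simp)).1 (hf.hasDerivWithinAt (s := Iio b))
  refine le_of_tendsto h1 ?_
  filter_upwards [Ioo_mem_nhdsLT hab] with x hx
  rw [slope_def_field, hb]
  exact div_nonpos_of_nonneg_of_nonpos (by linarith [hpos x hx]) (by linarith [hx.2])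

lemma const_sign {a b : ℝ} (hne : ∀ x ∈ Ioo a b, h x ≠ 0) :
    ∃ e : ℝ, (e = 1 ∨ e = -1) ∧ ∀ x ∈ Ioo a b, 0 < e * h x := by
  by_cases hp : ∀ x ∈ Ioo a b, 0 < h x
  · exact ⟨1, Or.inl rfl, fun x hx => by rw [one_mul]; exact hp x hx⟩
  · push Not at hp
    obtain ⟨y, hy, hy0⟩ := hp
    refine ⟨-1, Or.inr rfl, fun x hx => ?_⟩
    by_contra hcon
    have hx0 : 0 ≤ h x := by linarith
    obtain ⟨z, hz, hz0⟩ := isPreconnected_Ioo.intermediate_value hy hx h_cont.continuousOn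
      (⟨hy0, hx0⟩ : (0:ℝ) ∈ Icc (h y) (h x))
    exact hne z hz hz0

noncomputable def U (x : ℝ) : ℝ := √x * (x * h x)
noncomputable def P (x : ℝ) : ℝ := √x * (A x - h x / 2)

lemma U_cont : Continuous U := by
  have := h_cont
  unfold U; fun_prop

lemma P_cont : Continuous P := by
  have := h_cont
  have := A_cont
  unfold P; fun_prop

lemma U_deriv (x : ℝ) (hx : 0 < x) : HasDerivAt U (P x) x := by
  have h1 := (Real.hasDerivAt_sqrt hx.ne').mul ((hasDerivAt_id x).mul (h_deriv x hx))
  refine HasDerivAt.congr_deriv h1 ?_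
  have hs : √x ^ 2 = x := Real.sq_sqrt hx.le
  have hs0 : 0 < √x := Real.sqrt_pos.2 hx
  simp only [P, Pi.mul_apply, id]
  generalize √x = s at *
  subst hs
  field_simp
  ring

lemma P_deriv (x : ℝ) (hx : 0 < x) : HasDerivAt P ((3/4 - x^2) * h x / √x) x := by
  have h1 := (Real.hasDerivAt_sqrt hx.ne').mul ((A_deriv x).sub ((h_deriv x hx).div_const 2))
  refine HasDerivAt.congr_deriv h1 ?_
  have hs : √x ^ 2 = x := Real.sq_sqrt hx.le
  have hs0 : 0 < √x := Real.sqrt_pos.2 hx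
  simp only [Pi.sub_apply]
  generalize √x = s at *
  subst hs
  field_simp
  ring

lemma spacing {a b : ℝ} (ha : 0 ≤ a) (hab : a < b) (haz : a * h a = 0) (hbz : h b = 0)
    (hne : ∀ x ∈ Ioo a b, h x ≠ 0) : a + Real.pi < b := by
  by_contra hcon
  push Not at hcon
  obtain ⟨e, -, he⟩ := const_sign hne
  have hb0 : 0 < b := by linarith
  have h1 : e * (A b / b) ≤ 0 := by
    have := (h_deriv b hb0).const_mul e
    rw [hbz] at this
    have := deriv_nonpos_right hab this (by rw [hbz, mul_zero]) he
    simpa using this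
  have hc : Continuous (fun x => e * (Real.cos (x - a) * U x - Real.sin (x - a) * P x)) := by
    have := U_cont
    have := P_cont
    fun_prop
  have h2 := lt_of_deriv_neg (D := fun x => -(Real.sin (x - a) * (3/4) * (e * h x) / √x)) hab hc
    (by
      intro x hx
      have hx0 : 0 < x := by linarith [hx.1]
      have hsub : HasDerivAt (fun x => x - a) 1 x := (hasDerivAt_id x).sub_const a
      have := (((hsub.cos).mul (U_deriv x hx0)).sub ((hsub.sin).mul (P_deriv x hx0))).const_mul e
      refine HasDerivAt.congr_deriv this ?_
      have hs : √x ^ 2 = x := Real.sq_sqrt hx0.le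
      have hs0 : 0 < √x := Real.sqrt_pos.2 hx0
      simp only [U]
      generalize √x = s at *
      subst hs
      field_simp
      ring)
    (by
      intro x hx
      have hx0 : 0 < x := by linarith [hx.1]
      have hs0 : 0 < √x := Real.sqrt_pos.2 hx0
      have := Real.sin_pos_of_pos_of_lt_pi (x := x - a) (by linarith [hx.1]) (by linarith [hx.2])
      have := he x hx
      rw [neg_lt_zero]
      positivity)
  have hUa : U a = 0 := by rw [U, haz, mul_zero]
  have hUb : U b = 0 := by rw [U, hbz, mul_zero, mul_zero]
  have hPb : P b = √b * A b := by rw [P, hbz]; ring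
  simp only [hUa, hUb, sub_self, Real.sin_zero, hPb] at h2
  have hsin : 0 ≤ Real.sin (b - a) := Real.sin_nonneg_of_nonneg_of_le_pi (by linarith) (by linarith)
  have h3 : e * A b ≤ 0 := by
    have : e * A b = e * (A b / b) * b := by field_simp
    rw [this]
    exact mul_nonpos_of_nonpos_of_nonneg h1 hb0.le
  have h4 : 0 ≤ Real.sin (b - a) * √b := by positivity
  nlinarith [mul_nonneg h4 (neg_nonneg.2 h3)]

noncomputable def G (x : ℝ) : ℝ := Real.sin x - x * Real.cos x

lemma G_cont : Continuous G := by unfold G; fun_prop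

lemma G_deriv (x : ℝ) : HasDerivAt G (x * Real.sin x) x := by
  have := (Real.hasDerivAt_sin x).sub ((hasDerivAt_id x).mul (Real.hasDerivAt_cos x))
  refine HasDerivAt.congr_deriv this ?_
  simp

lemma exists_z (i : ℕ) : ∃ z, (i : ℝ) * Real.pi ≤ z ∧ z < ((i : ℝ) + 1/2) * Real.pi ∧ G z = 0 := by
  have hpi := Real.pi_pos
  have hle : (i : ℝ) * Real.pi ≤ ((i : ℝ) + 1/2) * Real.pi := by nlinarith
  have e1 : Real.sin ((i:ℝ) * Real.pi) = 0 := Real.sin_nat_mul_pi i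
  have e2 : Real.cos ((i:ℝ) * Real.pi) = (-1)^i := Real.cos_nat_mul_pi i
  have e3 : ((i : ℝ) + 1/2) * Real.pi = i * Real.pi + Real.pi/2 := by ring
  have hs : ((-1:ℝ)^i) * (-1)^i = 1 := by rw [← mul_pow]; simp
  have hG1 : (-1)^i * G (i * Real.pi) = - (i * Real.pi) := by
    rw [G, e1, e2]; linear_combination (-(i * Real.pi)) * hs
  have hG2 : (-1)^i * G ((i + 1/2) * Real.pi) = 1 := by
    rw [G, e3, Real.sin_add, Real.cos_add, e1, e2, Real.sin_pi_div_two, Real.cos_pi_div_two]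
    linear_combination hs
  have hc : ContinuousOn (fun x => (-1)^i * G x) (Icc (i * Real.pi) ((i + 1/2) * Real.pi)) := by
    have := G_cont
    fun_prop
  obtain ⟨z, hz, hz0⟩ := intermediate_value_Icc hle hc
    (show (0:ℝ) ∈ _ by
      simp only [hG1, hG2]
      exact ⟨by have : (0:ℝ) ≤ i * Real.pi := by positivity
                linarith, by norm_num⟩)
  have hz1 : G z = 0 := by
    simpa using hz0
  refine ⟨z, hz.1, lt_of_le_of_ne hz.2 ?_, hz1⟩
  rintro rfl
  rw [hz1] at hG2
  norm_num at hG2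

lemma sG_mono (i : ℕ) : StrictMonoOn (fun x => (-1)^i * G x) (Icc (i * Real.pi) ((i+1) * Real.pi)) := by
  have hpi := Real.pi_pos
  have := G_cont
  refine strictMonoOn_of_deriv_pos (convex_Icc _ _) (by fun_prop) ?_
  intro x hx
  rw [interior_Icc] at hx
  rw [((G_deriv x).const_mul _).deriv]
  have h1 := Real.sin_sub_nat_mul_pi x i
  have h2 := Real.sin_pos_of_pos_of_lt_pi (x := x - i * Real.pi) (by linarith [hx.1])
    (by linarith [hx.2])
  have hx0 : 0 < x := lt_of_le_of_lt (by positivity) hx.1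
  rw [h1] at h2
  nlinarith [mul_pos hx0 h2]

lemma sG_neg (i : ℕ) {a b : ℝ} (ha : (i : ℝ) * Real.pi ≤ a) (ha' : a < ((i : ℝ) + 1/2) * Real.pi)
    (hb : ((i:ℝ)+1) * Real.pi ≤ b) (hb' : b < ((i : ℝ) + 1 + 1/2) * Real.pi)
    (hGa : G a = 0) (hGb : G b = 0) (x : ℝ) (hx : x ∈ Ioo a b) : 0 < (-1)^i * G x := by
  have hpi := Real.pi_pos
  rcases le_or_gt x (((i:ℝ)+1) * Real.pi) with hl | hl
  · have := sG_mono i (⟨ha, by nlinarith⟩) (⟨by linarith [hx.1], hl⟩) hx.1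
    simpa [hGa] using this
  · have := sG_mono (i+1) (a := x) (b := b) ⟨by push_cast; linarith, by push_cast; nlinarith [hx.2]⟩
      ⟨by push_cast; linarith, by push_cast; nlinarith⟩ hx.2
    simp only [hGb, pow_succ] at this
    linarith

noncomputable def V (x : ℝ) : ℝ :=
  √x * ((A x + h x / 2) * (Real.sinc x - Real.cos x) - h x * x * Real.sin x)

lemma V_cont : Continuous V := by
  have := h_cont
  have := A_cont
  have := Real.continuous_sinc
  unfold V
  fun_prop

lemma V_eq (x : ℝ) (hx : 0 < x) : V x = P x * (G x / x) - U x * (Real.sin x - G x / x^2) := by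
  rw [V, P, U, G, Real.sinc_of_ne_zero hx.ne']
  field_simp
  ring

lemma V_deriv (x : ℝ) (hx : 0 < x) : HasDerivAt V (-(5/4 * √x * h x * G x / x^2)) x := by
  have hg : HasDerivAt (fun x => G x / x) _ x := (G_deriv x).div (hasDerivAt_id x) hx.ne'
  have hg2 : HasDerivAt (fun x => G x / x^2) _ x :=
    (G_deriv x).div (hasDerivAt_pow 2 x) (by positivity)
  have h1 := ((P_deriv x hx).mul hg).sub ((U_deriv x hx).mul ((Real.hasDerivAt_sin x).sub hg2))
  have h2 := h1.congr_of_eventuallyEq (f₁ := V) (by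
    filter_upwards [lt_mem_nhds hx] with y hy
    rw [V_eq y hy]
    rfl)
  refine h2.congr_deriv ?_
  have hs : √x ^ 2 = x := Real.sq_sqrt hx.le
  have hs0 : 0 < √x := Real.sqrt_pos.2 hx
  simp only [P, U, Pi.sub_apply, id, G]
  generalize √x = s at *
  generalize Real.sin x = S at *
  generalize Real.cos x = C at *
  subst hs
  field_simp
  ring

lemma V_zero (x : ℝ) (hx : 0 ≤ x) (hG : G x = 0) : V x = -(√x * h x * x * Real.sin x) := by
  rcases hx.eq_or_lt with rfl | hx
  · simp [V]
  · rw [V_eq x hx, hG, U]; ring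

lemma exists_zero (i : ℕ) {a b : ℝ} (ha : (i : ℝ) * Real.pi ≤ a)
    (ha' : a < ((i : ℝ) + 1/2) * Real.pi)
    (hb : ((i:ℝ)+1) * Real.pi ≤ b) (hb' : b < ((i : ℝ) + 1 + 1/2) * Real.pi)
    (hGa : G a = 0) (hGb : G b = 0) : ∃ x ∈ Ioo a b, h x = 0 := by
  by_contra hcon
  push Not at hcon
  have hpi := Real.pi_pos
  have hab : a < b := by nlinarith
  have ha0 : 0 ≤ a := le_trans (by positivity) ha
  obtain ⟨e, -, he⟩ := const_sign hcon
  have hcl : ∀ x ∈ Icc a b, 0 ≤ e * h x := by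
    intro x hx
    rw [← closure_Ioo hab.ne] at hx
    have : IsClosed {y | 0 ≤ e * h y} := isClosed_le continuous_const (h_cont.const_mul e)
    exact closure_minimal (fun y hy => (he y hy).le) this hx
  have hVc := V_cont
  have key := lt_of_deriv_neg (W := fun x => (e * (-1)^i) * V x) hab (by fun_prop)
    (fun x hx => (V_deriv x (by linarith [hx.1])).const_mul _)
    (by
      intro x hx
      have hx0 : 0 < x := by linarith [hx.1]
      have h1 := he x hx
      have h2 := sG_neg i ha ha' hb hb' hGa hGb x hx
      have hs0 : 0 < √x := Real.sqrt_pos.2 hx0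
      have : e * (-1)^i * -(5/4 * √x * h x * G x / x^2) =
        -(5/4 * √x * (e * h x) * ((-1)^i * G x) / x^2) := by ring
      rw [this, neg_lt_zero]
      positivity)
  simp only [V_zero a ha0 hGa, V_zero b (by linarith) hGb] at key
  have hsa := Real.sin_nonneg_of_nonneg_of_le_pi (x := a - i * Real.pi) (by linarith) (by nlinarith)
  have hsb := Real.sin_nonneg_of_nonneg_of_le_pi (x := b - (i+1 : ℕ) * Real.pi)
    (by push_cast; linarith) (by push_cast; nlinarith)
  rw [Real.sin_sub_nat_mul_pi] at hsa hsb
  have k1 : 0 ≤ √a * a * (e * h a) * ((-1)^i * Real.sin a) :=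
    mul_nonneg (mul_nonneg (by positivity) (hcl a (left_mem_Icc.2 hab.le))) hsa
  have hb0 : 0 ≤ b := by linarith
  have k2 : 0 ≤ √b * b * (e * h b) * ((-1)^(i+1) * Real.sin b) :=
    mul_nonneg (mul_nonneg (by positivity) (hcl b (right_mem_Icc.2 hab.le))) hsb
  rw [pow_succ] at k2
  nlinarith

end BZ

/-- The $i$-th smallest positive zero $j_i$ of $J_1$ satisfies $iπ < j_i < (i+1/2)π$. -/
theorem besselJ1_zero_bounds
    (j : ℕ → ℝ)
    (hjpos : ∀ i, 1 ≤ i → 0 < j i)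
    (hjzero : ∀ i, 1 ≤ i → besselJ1 (j i) = 0)
    (hjmono : ∀ i k, 1 ≤ i → i < k → j i < j k)
    (hjall : ∀ x : ℝ, 0 < x → besselJ1 x = 0 → ∃ i, 1 ≤ i ∧ x = j i)
    (i : ℕ) (hi : 1 ≤ i) :
    (i : ℝ) * Real.pi < j i ∧ j i < ((i : ℝ) + 1 / 2) * Real.pi := by
  have hz : ∀ x, 0 < x → (besselJ1 x = 0 ↔ BZ.h x = 0) := by
    intro x hx
    rw [BZ.J1_eq]
    simp [hx.ne']
  have hpi := Real.pi_pos
  constructor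
  · induction i, hi using Nat.le_induction with
    | base =>
      have := BZ.spacing (a := 0) (b := j 1) le_rfl (hjpos 1 le_rfl) (by simp)
        ((hz _ (hjpos 1 le_rfl)).1 (hjzero 1 le_rfl)) (by
          intro x hx h0
          obtain ⟨k, hk, rfl⟩ := hjall x hx.1 ((hz x hx.1).2 h0)
          rcases hk.eq_or_lt with rfl | hk'
          · exact lt_irrefl _ hx.2
          · exact lt_asymm hx.2 (hjmono 1 k le_rfl hk'))
      simpa using this
    | succ n hn ih =>
      have hn1 : 1 ≤ n + 1 := by omega
      have := BZ.spacing (a := j n) (b := j (n+1)) (hjpos n hn).le (hjmono n (n+1) hn (by omega))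
        (by rw [(hz _ (hjpos n hn)).1 (hjzero n hn), mul_zero])
        ((hz _ (hjpos _ hn1)).1 (hjzero _ hn1)) (by
          intro x hx h0
          have hx0 : 0 < x := (hjpos n hn).trans hx.1
          obtain ⟨k, hk, rfl⟩ := hjall x hx0 ((hz x hx0).2 h0)
          rcases lt_trichotomy k n with hlt | rfl | hlt
          · exact lt_asymm hx.1 (hjmono k n hk hlt)
          · exact lt_irrefl _ hx.1
          · rcases (Nat.succ_le_of_lt hlt).eq_or_lt with h | h
            · rw [← h] at hx
              exact lt_irrefl _ hx.2
            · exact lt_asymm hx.2 (hjmono (n+1) k hn1 h))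
      push_cast
      linarith
  · choose z hz1 hz2 hz3 using BZ.exists_z
    have hw : ∀ n : ℕ, ∃ k, 1 ≤ k ∧ z n < j k ∧ j k < z (n+1) := by
      intro n
      have h1 := hz1 (n+1)
      have h2 := hz2 (n+1)
      push_cast at h1 h2
      obtain ⟨x, hx, hx0⟩ := BZ.exists_zero n (hz1 n) (hz2 n) h1 h2 (hz3 n) (hz3 (n+1))
      have hxp : 0 < x := lt_of_le_of_lt (le_trans (by positivity) (hz1 n)) hx.1
      obtain ⟨k, hk, rfl⟩ := hjall x hxp ((hz x hxp).2 hx0)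
      exact ⟨k, hk, hx.1, hx.2⟩
    choose k hk1 hk2 hk3 using hw
    have hk : ∀ n, n + 1 ≤ k n := by
      intro n
      induction n with
      | zero => exact hk1 0
      | succ n ih =>
        have : k n < k (n+1) := by
          by_contra hcon
          have hle : k (n+1) ≤ k n := by omega
          have hlt : j (k n) < j (k (n+1)) := (hk3 n).trans (hk2 (n+1))
          rcases hle.eq_or_lt with h | h
          · rw [h] at hlt
            exact lt_irrefl _ hlt
          · exact lt_asymm hlt (hjmono _ _ (hk1 _) h)
        omega
    obtain ⟨n, rfl⟩ : ∃ n, i = n + 1 := ⟨i - 1, by omega⟩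
    have hle : j (n+1) ≤ j (k n) := by
      rcases (hk n).eq_or_lt with h | h
      · rw [← h]
      · exact (hjmono _ _ hi h).le
    exact (hle.trans_lt (hk3 n)).trans (hz2 (n+1))
end

section
/- For every integer i ≥ 1, y_{2i−1,4i} ≤ √(9/(8πi)); that is, the supremum of |P_{4i}| on the interval [z_{2i,4i}, z_{2i−1,4i}] between the 2i-th and (2i−1)-th largest positive zeros of P_{4i} is at most (8πi/9)^{−1/2}. -/
open MeasureTheory Filter

/-- The `n`-th Legendre polynomial, via Rodrigues formula:
`P_n(x) = (1/(2^n n!)) (d/dx)^n (x^2 - 1)^n`. -/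
noncomputable def legP (n : ℕ) : ℝ → ℝ := fun x =>
  (1 / ((2 : ℝ) ^ n * (n.factorial : ℝ))) *
    iteratedDeriv n (fun y : ℝ => (y ^ 2 - 1) ^ n) x

/-- Positive part of the `n`-th Legendre polynomial. -/
noncomputable def legPpos (n : ℕ) (x : ℝ) : ℝ := max (legP n x) 0

/-- Negative part of the `n`-th Legendre polynomial. -/
noncomputable def legPneg (n : ℕ) (x : ℝ) : ℝ := max (-legP n x) 0

open Polynomial
theorem main_abs (N : ℝ) (hN : 20 ≤ N) (P P' : ℝ → ℝ) 
  (hP : ∀ x, HasDerivAt P (P' x) x)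
  (hv : ∀ x, HasDerivAt (fun x => (1-x^2) * P' x) (-N * P x) x)
  (h0 : P' 0 = 0) (a d : ℝ) (ha : 0 < a) (had : a < d) (hd : d < 1)
  (hz : ∀ x, 0 < x → x < d → P x = 0 → x = a) (x : ℝ) (hax : a < x) (hxd : x < d)
  (hx : P' x = 0) : (P x)^2 ≤ 9/4 * (P 0)^2 := by
  have hG : AntitoneOn (fun x => (1-x^2) * N * (P x)^2 + ((1-x^2) * P' x)^2) (Set.Icc 0 1) := by
    have key : ∀ x, HasDerivAt (fun x => (1-x^2) * N * (P x)^2 + ((1-x^2) * P' x)^2) (-2*x*N*(P x)^2) x := by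
      intro x
      have h1 : HasDerivAt (fun x : ℝ => (1-x^2) * N) (-2*x*N) x := by
        have := (((hasDerivAt_id x).pow 2).const_sub 1).mul_const N
        exact this.congr_deriv (by simp)
      have := (h1.mul ((hP x).pow 2)).add ((hv x).pow 2)
      exact this.congr_deriv (by simp; ring)
    apply antitoneOn_of_deriv_nonpos (convex_Icc 0 1)
    · exact fun x _ => (key x).continuousAt.continuousWithinAt
    · exact fun x _ => (key x).differentiableAt.differentiableWithinAt
    · intro x hx
      rw [interior_Icc] at hx
      rw [(key x).deriv]
      have : 0 ≤ x * N * (P x)^2 := by have := hx.1; positivity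
      linarith
  have hG1 := hG (a := 0) (b := x) ⟨le_rfl, zero_le_one⟩ ⟨by linarith, by linarith⟩ (by linarith)
  simp only [h0, hx] at hG1
  have hG2 : (1-x^2) * (P x)^2 ≤ (P 0)^2 := by
    have : N * ((1-x^2) * (P x)^2) ≤ N * (P 0)^2 := by linarith
    exact le_of_mul_le_mul_left this (by linarith)
  suffices hs : x^2 ≤ 5/9 by nlinarith [sq_nonneg (P x)]
  obtain ⟨v, hvd⟩ : ∃ v : ℝ → ℝ, v = (fun x => (1-x^2) * P' x) := ⟨_, rfl⟩
  rw [← hvd] at hv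
  have hvc : Continuous v := continuous_iff_continuousAt.2 fun x => (hv x).continuousAt
  have v0 : v 0 = 0 := by simp [hvd, h0]
  have vx : v x = 0 := by simp [hvd, hx]
  have hN0 : N ≠ 0 := by linarith
  have hne : ∀ c, 0 < c → c < x → v c ≠ 0 := by
    intro c hc hcx hvc0
    obtain ⟨r, hr, hr'⟩ := exists_hasDerivAt_eq_zero hc hvc.continuousOn (by rw [v0, hvc0]) (fun x _ => hv x)
    obtain ⟨s, hs, hs'⟩ := exists_hasDerivAt_eq_zero hcx hvc.continuousOn (by rw [vx, hvc0]) (fun x _ => hv x)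
    have e1 := hz r hr.1 (by linarith [hr.2]) (by simpa [hN0] using hr')
    have e2 := hz s (by linarith [hs.1]) (by linarith [hs.2]) (by simpa [hN0] using hs')
    linarith [hr.2, hs.1]
  by_contra hcon
  push Not at hcon
  set k := √N with hk
  have hk2 : k^2 = N := Real.sq_sqrt (by linarith)
  have hkpos : 0 < k := Real.sqrt_pos.2 (by linarith)
  set b := Real.pi / k with hb
  have hbpos : 0 < b := by positivity
  have hkb : k * b = Real.pi := by rw [hb]; field_simp
  have hbx : b < x := by
    apply lt_of_pow_lt_pow_left₀ 2 (by linarith)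
    have : b^2 * N = Real.pi^2 := by rw [← hk2, ← hkb]; ring
    nlinarith [Real.pi_lt_d2, Real.pi_pos, sq_nonneg b]
  have stu : ∀ e : ℝ, e ≠ 0 → (∀ c, 0 < c → c < x → 0 < e * v c) → False := by
    intro e he hpos
    have key : ∀ t, t^2 ≠ 1 → HasDerivAt (fun t => e * (-N * P t * Real.sin (k*t) - v t * (Real.cos (k*t)*k)))
       (e * (-N * P' t * Real.sin (k * t) + N * v t * Real.sin (k*t))) t := by
      intro t ht
      have hl : HasDerivAt (fun t : ℝ => k * t) k t := by simpa using (hasDerivAt_id t).const_mul k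
      have := (((((hP t).const_mul (-N)).mul hl.sin)).sub ((hv t).mul (hl.cos.mul_const k))).const_mul e
      exact this.congr_deriv (by rw [← hk2]; ring)
    have lt1 : ∀ t, 0 ≤ t → t ≤ b → t^2 ≠ 1 := fun t h1 h2 => by nlinarith
    have anti : AntitoneOn (fun t => e * (-N * P t * Real.sin (k*t) - v t * (Real.cos (k*t)*k))) (Set.Icc 0 b) := by
      apply antitoneOn_of_deriv_nonpos (convex_Icc 0 b)
      · exact fun x hx => (key x (lt1 x hx.1 hx.2)).continuousAt.continuousWithinAt
      · intro x hx
        rw [interior_Icc] at hx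
        exact (key x (lt1 x hx.1.le hx.2.le)).differentiableAt.differentiableWithinAt
      · intro t ht
        rw [interior_Icc] at ht
        rw [(key t (lt1 t ht.1.le ht.2.le)).deriv]
        have hs : 0 ≤ Real.sin (k*t) := Real.sin_nonneg_of_nonneg_of_le_pi (by have := ht.1; positivity) (by rw [← hkb]; gcongr; exact ht.2.le)
        have hp := hpos t ht.1 (by linarith [ht.2])
        have ht2 : 0 < 1 - t^2 := by nlinarith [ht.1, ht.2]
        have hp' : 0 < e * P' t := by
          have : 0 < (1-t^2) * (e * P' t) := by rw [hvd] at hp; simp only at hp; linarith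
          exact pos_of_mul_pos_right this ht2.le
        have : e * (-N * P' t * Real.sin (k * t) + N * v t * Real.sin (k*t)) = - (t^2 * (N * Real.sin (k*t) * (e * P' t))) := by
          rw [hvd]; ring
        rw [this]
        have : 0 ≤ t^2 * (N * Real.sin (k*t) * (e * P' t)) := by positivity
        linarith
    have := anti (a := 0) (b := b) ⟨le_rfl, hbpos.le⟩ ⟨hbpos.le, le_rfl⟩ hbpos.le
    simp only [hkb, v0, mul_zero, Real.sin_zero, Real.sin_pi, Real.cos_pi] at this
    nlinarith [hpos b hbpos hbx]
  have hb0 := hne b hbpos hbx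
  apply stu (v b) hb0
  intro c hc hcx
  by_contra hneg
  push Not at hneg
  have hpc : IsPreconnected (v '' Set.Ioo 0 x) := isPreconnected_Ioo.image _ hvc.continuousOn
  have hoc := hpc.ordConnected
  have h1 : v b ∈ v '' Set.Ioo 0 x := ⟨b, ⟨hbpos, hbx⟩, rfl⟩
  have h2 : v c ∈ v '' Set.Ioo 0 x := ⟨c, ⟨hc, hcx⟩, rfl⟩
  have h3 : (0:ℝ) ∈ v '' Set.Ioo 0 x := by
    rcases lt_or_gt_of_ne hb0 with h | h
    · exact hoc.out h1 h2 ⟨h.le, by nlinarith⟩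
    · exact hoc.out h2 h1 ⟨by nlinarith, h.le⟩
  obtain ⟨c, hc, h⟩ := h3
  exact hne c hc.1 hc.2 h

theorem cb_bound (m : ℕ) (hm : 1 ≤ m) : ((m.centralBinom : ℝ) / 4^m)^2 ≤ 1 / (Real.pi * m) := by
  have h1 := Real.Wallis.le_W m
  rw [Real.Wallis.W_eq_factorial_ratio] at h1
  have h2 : ((m.centralBinom : ℝ)) * (m.factorial:ℝ)^2 = ((2*m).factorial : ℝ) := by
    have := Nat.choose_mul_factorial_mul_factorial (show m ≤ 2 * m by omega)
    rw [show 2 * m - m = m by omega, ← Nat.centralBinom_eq_two_mul_choose] at this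
    rw [← this]; push_cast; ring
  have hc : (0:ℝ) < m.centralBinom := by exact_mod_cast m.centralBinom_pos
  have hf : (0:ℝ) < m.factorial := by positivity
  have hm' : (1:ℝ) ≤ m := by exact_mod_cast hm
  rw [← h2, show (2:ℝ)^(4*m) = (4^m)^2 by rw [← pow_mul, mul_comm 4 m, show (4:ℝ) = 2^2 by norm_num, ← pow_mul]; congr 1; ring] at h1
  have hq : (0:ℝ) < 4^m := by positivity
  generalize (4:ℝ)^m = q at *
  have h3 : q^2 * (m.factorial : ℝ)^4 / ((m.centralBinom * (m.factorial:ℝ)^2)^2 * (2*m+1)) = q^2 / ((m.centralBinom:ℝ)^2 * (2*m+1)) := by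
    field_simp
  rw [h3] at h1
  rw [le_div_iff₀ (by positivity)] at h1
  rw [div_pow, div_le_div_iff₀ (by positivity) (by positivity)]
  have h4 : (2*(m:ℝ)+1)^2 * Real.pi * (m.centralBinom:ℝ)^2 ≤ 4 * (m+1) * q^2 := by
    have : (2*(m:ℝ)+1)/(2*m+2) * (Real.pi/2) * ((m.centralBinom:ℝ)^2 * (2*m+1)) = (2*(m:ℝ)+1)^2 * Real.pi * (m.centralBinom:ℝ)^2 / (4*(m+1)) := by
      field_simp; ring
    rw [this, div_le_iff₀ (by positivity)] at h1
    linarith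
  have h5 : 0 ≤ Real.pi * (m.centralBinom:ℝ)^2 := by positivity
  have h6 : 4 * (m+1) * (Real.pi * m * (m.centralBinom:ℝ)^2) ≤ 4 * (m+1) * q^2 := by nlinarith
  have := le_of_mul_le_mul_left h6 (by positivity)
  linarith

theorem leg_ode (n k : ℕ) : ((X:ℝ[X])^2-1) * derivative^[k+2] ((X^2-1)^n) = 
   C (2 * ((n:ℝ)-k-1)) * X * derivative^[k+1] ((X^2-1)^n) + C ((k+1)*(2*(n:ℝ)-k)) * derivative^[k] ((X^2-1)^n) := by
  have base : ((X:ℝ[X])^2-1) * derivative ((X^2-1)^n) = C (2 * (n:ℝ)) * X * ((X^2-1)^n) := by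
    rcases n with _ | n
    · simp
    · rw [derivative_pow]; simp [show (C 2 : ℝ[X]) = 2 from rfl]; ring
  induction k with
  | zero =>
    have := congrArg derivative base
    simp only [derivative_mul, derivative_C, derivative_sub, derivative_one, derivative_X_pow, derivative_X] at this
    simp only [Function.iterate_succ, Function.iterate_zero, Function.comp, id] 
    simp [show (C 2 : ℝ[X]) = 2 from rfl] at this ⊢
    linear_combination this
  | succ k ih =>
    have := congrArg derivative ih
    simp only [derivative_mul, derivative_add, derivative_C, derivative_sub, derivative_one, derivative_X_pow, derivative_X, ← Function.iterate_succ_apply' derivative] at this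
    simp [show (C 2 : ℝ[X]) = 2 from rfl, show k+1+1=k+2 from rfl, show k+1+2=k+3 from rfl] at this ⊢
    linear_combination this

theorem leg_coeff (n j : ℕ) : (((X:ℝ[X])^2-1)^n).coeff (2*j) = (-1:ℝ)^(n-j) * (n.choose j : ℝ) ∧ (((X:ℝ[X])^2-1)^n).coeff (2*j+1) = 0 := by
  have : ((X:ℝ[X])^2-1)^n = expand ℝ 2 ((X + C (-1))^n) := by simp [sub_eq_add_neg]
  rw [this]
  constructor
  · rw [mul_comm, coeff_expand_mul (by norm_num), coeff_X_add_C_pow]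
  · rw [coeff_expand (by norm_num), if_neg (by omega)]

noncomputable def legPoly (n : ℕ) : ℝ[X] := C (1 / ((2 : ℝ) ^ n * (n.factorial : ℝ))) * derivative^[n] ((X^2-1)^n)

theorem iter_eval (p : ℝ[X]) (k : ℕ) : iteratedDeriv k (fun x => p.eval x) = fun x => (derivative^[k] p).eval x := by
  induction k with
  | zero => simp
  | succ k ih => rw [iteratedDeriv_succ, ih, Function.iterate_succ_apply']; ext x; simp


theorem legP_eq (n : ℕ) (x : ℝ) : legP n x = (legPoly n).eval x := by
  have h : (fun y : ℝ => (y ^ 2 - 1) ^ n) = fun y => (((X:ℝ[X])^2-1)^n).eval y := by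
    ext y; simp
  rw [legP, h, iter_eval, legPoly, eval_mul, eval_C]

theorem legPoly_ode (n : ℕ) : derivative ((1 - X^2) * derivative (legPoly n)) = C (-((n:ℝ)*(n+1))) * legPoly n := by
  have h := leg_ode n n
  simp only [legPoly, derivative_mul, derivative_C, derivative_sub, derivative_one, derivative_X_pow,
    zero_mul, zero_add, ← Function.iterate_succ_apply' derivative]
  generalize 1 / ((2:ℝ)^n * (n.factorial:ℝ)) = c
  rw [show n.succ.succ = n+2 from rfl, show n.succ = n + 1 from rfl]
  generalize derivative^[n+2] (((X:ℝ[X])^2-1)^n) = A at *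
  generalize derivative^[n+1] (((X:ℝ[X])^2-1)^n) = B at *
  generalize derivative^[n] (((X:ℝ[X])^2-1)^n) = D at *
  simp [show (C 2 : ℝ[X]) = 2 from rfl] at h ⊢
  linear_combination (-C c) * h

theorem legPoly_zero (m : ℕ) : ((legPoly (2*m)).eval 0)^2 = ((m.centralBinom : ℝ) / 4^m)^2 := by
  rw [legPoly, eval_mul, eval_C, ← coeff_zero_eq_eval_zero, coeff_iterate_derivative, zero_add,
    (leg_coeff (2*m) m).1, Nat.descFactorial_self, nsmul_eq_mul, Nat.centralBinom_eq_two_mul_choose,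
    pow_mul, show (2:ℝ)^2 = 4 by norm_num]
  have : ((2*m).factorial : ℝ) ≠ 0 := by positivity
  rw [show ((1:ℝ) / (4 ^ m * ((2 * m).factorial:ℝ)) * (((2 * m).factorial:ℝ) * ((-1) ^ (2 * m - m) * ((2 * m).choose m:ℝ)))) = (-1) ^ (2 * m - m) * (((2 * m).choose m:ℝ) / 4^m) by field_simp]
  rw [mul_pow, ← pow_mul, mul_comm (2*m-m) 2, pow_mul]; simp

theorem legPoly_deriv_zero (m : ℕ) : (derivative (legPoly (2*m))).eval 0 = 0 := by
  rw [legPoly, derivative_mul, derivative_C, zero_mul, zero_add, ← Function.iterate_succ_apply' derivative, eval_mul, 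
    ← coeff_zero_eq_eval_zero, ← coeff_zero_eq_eval_zero, coeff_iterate_derivative, zero_add, Nat.succ_eq_add_one,
    (leg_coeff (2*m) m).2]
  simp

/-- $y_{2i-1,4i} ≤ √(9/(8πi))$: the sup of $|P_{4i}|$ on the interval between its
$2i$-th and $(2i-1)$-th largest zeros in $(0,1)$ is at most $(8πi/9)^{-1/2}$. -/
theorem extremal_value_le (i : ℕ) (hi : 1 ≤ i)
    (z : ℕ → ℝ)
    (hzmem : ∀ k, 1 ≤ k → k ≤ 2 * i →
      z k ∈ Set.Ioo (0:ℝ) 1 ∧ legP (4 * i) (z k) = 0)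
    (hzanti : ∀ k l, 1 ≤ k → k < l → l ≤ 2 * i → z l < z k)
    (hzall : ∀ x ∈ Set.Ioo (0:ℝ) 1, legP (4 * i) x = 0 →
      ∃ k, 1 ≤ k ∧ k ≤ 2 * i ∧ x = z k)
    (y : ℝ)
    (hy : IsLUB ((fun x => |legP (4 * i) x|) '' Set.Icc (z (2 * i)) (z (2 * i - 1))) y) :
    y ≤ Real.sqrt (9 / (8 * Real.pi * (i : ℝ))) := by
  have hz1 := hzmem (2*i) (by omega) le_rfl
  have hz2 := hzmem (2*i-1) (by omega) (by omega)
  have hlt := hzanti (2*i-1) (2*i) (by omega) (by omega) le_rfl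
  have hfun : legP (4*i) = fun x => (legPoly (4*i)).eval x := _root_.funext (legP_eq _)
  have hc : Continuous (fun x => |legP (4 * i) x|) := by
    rw [hfun]; exact (legPoly (4*i)).continuous.abs
  obtain ⟨x, hx, hmax⟩ := isCompact_Icc.exists_isMaxOn (Set.nonempty_Icc.2 hlt.le) hc.continuousOn
  have hyx : y ≤ |legP (4*i) x| := by
    apply hy.2
    rintro _ ⟨t, ht, rfl⟩
    exact hmax ht
  refine hyx.trans ?_
  by_cases hPx : legP (4*i) x = 0
  · rw [hPx, abs_zero]; positivity
  have hxa : z (2*i) < x := lt_of_le_of_ne hx.1 (fun h => hPx (h ▸ hz1.2))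
  have hxb : x < z (2*i-1) := lt_of_le_of_ne hx.2 (fun h => hPx (h ▸ hz2.2))
  have hD : ∀ x, HasDerivAt (legP (4*i)) ((derivative (legPoly (4*i))).eval x) x := by
    intro x; rw [hfun]; exact (legPoly (4*i)).hasDerivAt x
  have hi' : (1:ℝ) ≤ i := by exact_mod_cast hi
  have hcrit : (derivative (legPoly (4*i))).eval x = 0 := by
    have hloc : IsLocalMax (fun x => (legP (4*i) x)^2) x := by
      have : Set.Icc (z (2*i)) (z (2*i-1)) ∈ nhds x := Icc_mem_nhds hxa hxb
      filter_upwards [this] with t ht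
      exact sq_le_sq.2 (hmax ht)
    have := hloc.hasDerivAt_eq_zero ((hD x).pow 2)
    simpa [hPx] using this
  have h44 : 4 * i = 2 * (2 * i) := by ring
  have hmain := main_abs (((4*i:ℕ):ℝ)*((4*i:ℕ)+1)) (by push_cast; nlinarith) (legP (4*i))
    (fun x => (derivative (legPoly (4*i))).eval x) hD
    (by
      intro x
      have := ((1 - X^2) * derivative (legPoly (4*i))).hasDerivAt x
      rw [legPoly_ode] at this
      simp only [eval_mul, eval_C, eval_sub, eval_one, eval_pow, eval_X] at this
      rw [legP_eq]
      exact this)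
    (by rw [h44]; exact legPoly_deriv_zero _)
    (z (2*i)) (z (2*i-1)) hz1.1.1 hlt hz2.1.2
    (by
      intro t ht0 ht ht'
      obtain ⟨k, hk1, hk2, rfl⟩ := hzall t ⟨ht0, ht.trans hz2.1.2⟩ ht'
      have : ¬ k ≤ 2*i-1 := by
        intro hk
        rcases hk.lt_or_eq with h | h
        · exact absurd (hzanti k (2*i-1) hk1 h (by omega)) (by linarith)
        · rw [h] at ht; exact lt_irrefl _ ht
      congr 1; omega)
    x hxa hxb hcrit
  apply Real.le_sqrt_of_sq_le
  rw [sq_abs]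
  refine hmain.trans ?_
  have h1 := cb_bound (2*i) (by omega)
  rw [← legPoly_zero, ← h44, ← legP_eq] at h1
  calc _ ≤ 9/4 * (1 / (Real.pi * ((2*i:ℕ):ℝ))) := by gcongr
    _ = _ := by push_cast; field_simp; ring
end

section
/- For every integer i ≥ 1, |J₀(j_{2i−1})| ≤ √(2/(π²(2i−1))), where j_{2i−1} is the (2i−1)-th smallest positive zero of J₁. -/
noncomputable def gB (m : ℕ) (z : ℝ) : ℝ :=
  ∑' k : ℕ, (-z) ^ k / ((k.factorial : ℝ) * ((k + m).factorial : ℝ))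

lemma gB_summable_norm (m : ℕ) (z : ℝ) :
    Summable (fun k : ℕ => ‖(-z) ^ k / ((k.factorial : ℝ) * ((k + m).factorial : ℝ))‖) := by
  refine Summable.of_nonneg_of_le (fun _ => norm_nonneg _) ?_ (Real.summable_pow_div_factorial |z|)
  intro k
  rw [norm_div, norm_pow, norm_neg, Real.norm_eq_abs, Real.norm_eq_abs,
    abs_of_pos (a := (k.factorial : ℝ) * ((k + m).factorial : ℝ)) (by positivity)]
  have h1 : (1:ℝ) ≤ ((k+m).factorial : ℝ) := by exact_mod_cast Nat.factorial_pos _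
  apply div_le_div_of_nonneg_left (by positivity) (by positivity)
  exact le_mul_of_one_le_right (by positivity) h1

lemma gB_summable (m : ℕ) (z : ℝ) :
    Summable (fun k : ℕ => (-z) ^ k / ((k.factorial : ℝ) * ((k + m).factorial : ℝ))) :=
  (gB_summable_norm m z).of_norm

lemma gB_hasDerivAt (m : ℕ) (z : ℝ) : HasDerivAt (gB m) (-gB (m+1) z) z := by
  have hR : z ∈ Metric.ball (0:ℝ) (|z|+1) := by simp
  have hu : Summable (fun k : ℕ => (k:ℝ) * (|z|+1)^(k-1) / k.factorial) := by
    rw [← summable_nat_add_iff 1]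
    refine (Real.summable_pow_div_factorial (|z|+1)).congr ?_
    intro k
    simp only [Nat.factorial_succ, Nat.add_sub_cancel]
    push_cast
    field_simp
  have key := hasDerivAt_tsum_of_isPreconnected (𝕜 := ℝ)
    (g := fun (k:ℕ) (y:ℝ) => (-y) ^ k / ((k.factorial : ℝ) * ((k + m).factorial : ℝ)))
    (g' := fun (k:ℕ) (y:ℝ) => ((k:ℝ) * (-y)^(k-1) * (-1)) / ((k.factorial : ℝ) * ((k + m).factorial : ℝ)))
    hu Metric.isOpen_ball (convex_ball (0:ℝ) (|z|+1)).isPreconnected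
    (fun k y _ => by
      have := ((hasDerivAt_id y).neg.pow k).div_const ((k.factorial : ℝ) * ((k + m).factorial : ℝ))
      simpa using this)
    (fun k y hy => by
      have hy' : |y| ≤ |z|+1 := by
        have := Metric.mem_ball.1 hy
        rw [dist_zero_right, Real.norm_eq_abs] at this; exact this.le
      have h1 : (1:ℝ) ≤ ((k+m).factorial : ℝ) := by exact_mod_cast Nat.factorial_pos _
      rw [norm_div, norm_mul, norm_mul, norm_pow, norm_neg, norm_neg, norm_one, mul_one,
        Real.norm_eq_abs, Real.norm_eq_abs, Real.norm_eq_abs,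
        abs_of_nonneg (Nat.cast_nonneg k),
        abs_of_pos (a := (k.factorial : ℝ) * ((k + m).factorial : ℝ)) (by positivity)]
      apply div_le_div₀ (by positivity) _ (by positivity)
      · exact le_mul_of_one_le_right (by positivity) h1
      · gcongr)
    hR (gB_summable m z) hR
  refine key.congr_deriv ?_
  have hs : Summable (fun k : ℕ => ((k:ℝ) * (-z)^(k-1) * (-1)) / ((k.factorial : ℝ) * ((k + m).factorial : ℝ))) := by
    rw [← summable_nat_add_iff 1]
    refine (gB_summable (m+1) z).neg.congr ?_
    intro k
    rw [show k + 1 + m = k + (m+1) by ring]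
    simp only [Nat.factorial_succ k, Nat.add_sub_cancel]
    push_cast
    field_simp
  rw [hs.tsum_eq_zero_add]
  simp only [gB, ← tsum_neg]
  simp only [Nat.cast_zero, zero_mul, zero_div, zero_add]
  refine tsum_congr fun k => ?_
  rw [show k + 1 + m = k + (m+1) by ring]
  simp only [Nat.factorial_succ k, Nat.add_sub_cancel]
  push_cast
  field_simp

lemma gB_rec (z : ℝ) : gB 0 z = gB 1 z - z * gB 2 z := by
  have h0 : HasSum (fun k : ℕ => (k:ℝ) * (-z)^k / ((k.factorial : ℝ) * ((k + 1).factorial : ℝ))) (-z * gB 2 z) := by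
    rw [← hasSum_nat_add_iff' 1]
    simp only [Finset.range_one, Finset.sum_singleton, Nat.cast_zero, zero_mul, zero_div, sub_zero]
    refine ((gB_summable 2 z).hasSum.mul_left (-z)).congr_fun ?_
    intro k
    simp only [Nat.factorial_succ]
    push_cast
    field_simp
    ring
  have h1 := (gB_summable 1 z).hasSum.add h0
  have : HasSum (fun k : ℕ => (-z) ^ k / ((k.factorial : ℝ) * ((k + 0).factorial : ℝ))) (gB 1 z + -z * gB 2 z) := by
    refine h1.congr_fun ?_
    intro k
    simp only [Nat.factorial_succ, add_zero]
    push_cast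
    field_simp
    ring
  rw [gB, this.tsum_eq]; ring

lemma J0_eq (x : ℝ) : besselJ0 x = gB 0 (x^2/4) := by
  unfold besselJ0 gB
  refine tsum_congr fun k => ?_
  rw [neg_pow (x^2/4), add_zero, pow_mul, show (x/2)^2 = x^2/4 by ring]
  ring

lemma J1_eq (x : ℝ) : besselJ1 x = x/2 * gB 1 (x^2/4) := by
  unfold besselJ1 gB
  rw [← tsum_mul_left]
  refine tsum_congr fun k => ?_
  rw [neg_pow (x^2/4), pow_succ, pow_mul, show (x/2)^2 = x^2/4 by ring]
  ring

lemma sq_deriv (x : ℝ) : HasDerivAt (fun x : ℝ => x^2/4) (x/2) x := by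
  have := ((hasDerivAt_id x).pow 2).div_const 4
  refine this.congr_deriv ?_
  simp; ring

lemma gx_deriv (m : ℕ) (x : ℝ) : HasDerivAt (fun x => gB m (x^2/4)) (-gB (m+1) (x^2/4) * (x/2)) x :=
  HasDerivAt.comp (h₂ := gB m) x (gB_hasDerivAt m (x^2/4)) (sq_deriv x)

lemma J0_deriv (x : ℝ) : HasDerivAt besselJ0 (-besselJ1 x) x := by
  have := gx_deriv 0 x
  rw [show besselJ0 = fun x => gB 0 (x^2/4) from funext J0_eq, J1_eq]
  refine this.congr_deriv (by simp; ring)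

lemma J1_deriv (x : ℝ) : HasDerivAt besselJ1 (besselJ0 x - gB 1 (x^2/4)/2) x := by
  have := ((hasDerivAt_id x).div_const 2).mul (gx_deriv 1 x)
  rw [show besselJ1 = fun x => x/2 * gB 1 (x^2/4) from funext J1_eq, J0_eq, gB_rec]
  refine this.congr_deriv (by simp; ring)

lemma gB0_sq (z : ℝ) : HasSum (fun n : ℕ => (-z)^n * (Nat.centralBinom n : ℝ) / (n.factorial:ℝ)^2) ((gB 0 z)^2) := by
  have h := (summable_norm_sum_mul_antidiagonal_of_summable_norm (gB_summable_norm 0 z) (gB_summable_norm 0 z)).of_norm.hasSum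
  rw [← tsum_mul_tsum_eq_tsum_sum_antidiagonal_of_summable_norm (gB_summable_norm 0 z) (gB_summable_norm 0 z)] at h
  rw [sq]
  refine h.congr_fun ?_
  intro n
  have := Nat.add_choose_eq n n n
  rw [Nat.centralBinom, two_mul, this]
  push_cast
  rw [Finset.mul_sum, Finset.sum_div]
  refine Finset.sum_congr rfl ?_
  rintro ⟨i, j⟩ hij
  have hij' : i + j = n := by simpa using hij
  subst hij'
  rw [Nat.cast_add_choose, Nat.choose_symm_add (a := i) (b := j) |>.symm, Nat.cast_add_choose, pow_add]
  simp only [add_zero]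
  field_simp

lemma gB1_sq (z : ℝ) : HasSum (fun n : ℕ => (-z)^n * ((2*n+2).choose n : ℝ) / ((n+1).factorial:ℝ)^2) ((gB 1 z)^2) := by
  have h := (summable_norm_sum_mul_antidiagonal_of_summable_norm (gB_summable_norm 1 z) (gB_summable_norm 1 z)).of_norm.hasSum
  rw [← tsum_mul_tsum_eq_tsum_sum_antidiagonal_of_summable_norm (gB_summable_norm 1 z) (gB_summable_norm 1 z)] at h
  rw [sq]
  refine h.congr_fun ?_
  intro n
  have := Nat.add_choose_eq (n+1) (n+1) n
  rw [show 2*n+2 = (n+1)+(n+1) by ring, this]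
  push_cast
  rw [Finset.mul_sum, Finset.sum_div]
  refine Finset.sum_congr rfl ?_
  rintro ⟨i, j⟩ hij
  have hij' : i + j = n := by simpa using hij
  subst hij'
  have e1 : ((i+j+1).choose i : ℝ) = ((i+j+1).factorial:ℝ) / (i.factorial * (j+1).factorial) := by
    rw [add_assoc, Nat.cast_add_choose]
  have e2 : ((i+j+1).choose j : ℝ) = ((i+j+1).factorial:ℝ) / (j.factorial * (i+1).factorial) := by
    rw [show i+j+1 = j + (i+1) by ring, Nat.cast_add_choose]
  simp only [e1, e2, pow_add]
  field_simp

lemma S_sum (z : ℝ) : HasSum (fun n : ℕ => (-z)^n * ((Nat.centralBinom n : ℝ) / (n+1)) / (n.factorial:ℝ)^2)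
    ((gB 0 z)^2 + z * (gB 1 z)^2) := by
  rw [← hasSum_nat_add_iff' 1]
  have h0 := (hasSum_nat_add_iff' 1).2 (gB0_sq z)
  have h1 := (gB1_sq z).mul_left z
  have h2 := h0.add h1
  convert h2 using 1
  · funext n
    have e := Nat.choose_succ_right_eq (2*n+2) n
    rw [show 2*n+2-n = n+2 by omega] at e
    have e' : ((2*n+2).choose (n+1) : ℝ) * (n+1) = (2*n+2).choose n * (n+2) := by exact_mod_cast e
    have e3 : ((2*n+2).choose n : ℝ) = ((2*n+2).choose (n+1) : ℝ) * (n+1) / (n+2) := by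
      field_simp; linarith
    rw [e3, Nat.centralBinom, show 2*(n+1) = 2*n+2 by ring, pow_succ]
    push_cast
    field_simp
    ring
  · simp
    ring


lemma G_deriv (x : ℝ) (hx : 0 < x) : HasDerivAt (fun x => gB 1 (x^2/4))
    (-(2/x) * (gB 1 (x^2/4) - besselJ0 x)) x := by
  refine (gx_deriv 1 x).congr_deriv ?_
  rw [J0_eq, gB_rec]
  field_simp
  ring

lemma left_neg {f : ℝ → ℝ} {f' a b : ℝ} (hab : a < b) (hf : HasDerivAt f f' b) (hf' : 0 < f')
    (hb : f b = 0) : ∃ x ∈ Set.Ioo a b, f x < 0 := by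
  have h1 := (hasDerivAt_iff_tendsto_slope.1 hf).mono_left
    (nhdsWithin_mono b (fun x (hx : x ∈ Set.Iio b) => (ne_of_lt hx : x ≠ b)))
  have h2 := h1.eventually (lt_mem_nhds hf')
  have h3 : ∀ᶠ x in nhdsWithin b (Set.Iio b), x ∈ Set.Ioo a b := Ioo_mem_nhdsLT hab
  obtain ⟨x, hx, hx2⟩ := (h2.and h3).exists
  refine ⟨x, hx2, ?_⟩
  rw [slope_def_field, hb, sub_zero, div_eq_mul_inv] at hx
  have : (b - x) > 0 := sub_pos.2 hx2.2
  have h5 : x - b < 0 := sub_neg.2 hx2.2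
  have h4 : (x-b)⁻¹ < 0 := inv_lt_zero.2 h5
  by_contra hn
  push Not at hn
  nlinarith

lemma W_deriv (a x : ℝ) (hx : 0 < x) : HasDerivAt (fun x : ℝ => √x *
    (besselJ0 x * Real.sin (x - a) - gB 1 (x^2/4) / 4 * Real.sin (x-a) - besselJ1 x * Real.cos (x-a)))
    (√x * Real.sin (x-a) * besselJ1 x * (3/4/x^2)) x := by
  have hs : HasDerivAt (fun x : ℝ => √x) (√x/(2*x)) x := by
    refine (Real.hasDerivAt_sqrt hx.ne').congr_deriv ?_
    have := Real.sq_sqrt hx.le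
    have h2 : 0 < √x := Real.sqrt_pos.2 hx
    field_simp
    linarith
  have hsin : HasDerivAt (fun x : ℝ => Real.sin (x - a)) (Real.cos (x-a)) x := by
    simpa using ((hasDerivAt_id x).sub_const a).sin
  have hcos : HasDerivAt (fun x : ℝ => Real.cos (x - a)) (-Real.sin (x-a)) x := by
    simpa using ((hasDerivAt_id x).sub_const a).cos
  have := hs.mul ((((J0_deriv x).mul hsin).sub (((G_deriv x hx).div_const 4).mul hsin)).sub
    ((J1_deriv x).mul hcos))
  refine this.congr_deriv ?_
  rw [J1_eq]
  simp only [Pi.mul_apply, Pi.sub_apply, J1_eq]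
  field_simp
  ring

lemma J1_cont : Continuous besselJ1 :=
  continuous_iff_continuousAt.2 fun x => (J1_deriv x).continuousAt
lemma J0_cont : Continuous besselJ0 :=
  continuous_iff_continuousAt.2 fun x => (J0_deriv x).continuousAt
lemma G_cont (m : ℕ) : Continuous (fun x : ℝ => gB m (x^2/4)) :=
  continuous_iff_continuousAt.2 fun x => (gx_deriv m x).continuousAt

lemma gap_aux (σ a b : ℝ) (ha : 0 ≤ a) (hab : a < b) (h0 : besselJ1 a = 0) (h1 : besselJ1 b = 0)
    (hz : ∀ x ∈ Set.Ioo a b, 0 < σ * besselJ1 x) : Real.pi ≤ b - a := by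
  by_contra hlt
  push Not at hlt
  have hb : 0 < b := by linarith
  have hmono : StrictMonoOn (fun x : ℝ => σ * (√x *
    (besselJ0 x * Real.sin (x - a) - gB 1 (x^2/4) / 4 * Real.sin (x-a) - besselJ1 x * Real.cos (x-a))))
      (Set.Icc a b) := by
    apply strictMonoOn_of_deriv_pos (convex_Icc a b)
    · apply Continuous.continuousOn
      have := J1_cont
      have := J0_cont
      have := G_cont 1
      fun_prop
    · intro x hx
      rw [interior_Icc] at hx
      have hx0 : 0 < x := lt_of_le_of_lt ha hx.1
      rw [((W_deriv a x hx0).const_mul σ).deriv]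
      have h2 := hz x hx
      have h3 : 0 < Real.sin (x-a) := Real.sin_pos_of_pos_of_lt_pi (by linarith [hx.1]) (by linarith [hx.2])
      have : 0 < (σ * besselJ1 x) * (√x * Real.sin (x-a) * (3/4/x^2)) := by
        have := Real.sqrt_pos.2 hx0
        positivity
      linarith
  have h := hmono (Set.left_mem_Icc.2 hab.le) (Set.right_mem_Icc.2 hab.le) hab
  have hG : gB 1 (b^2/4) = 0 := by
    have := h1
    rw [J1_eq] at this
    rcases mul_eq_zero.1 this with h | h
    · linarith
    · exact h
  simp only [sub_self, Real.sin_zero, h0, h1, hG] at h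
  have h3 : 0 < Real.sin (b-a) := Real.sin_pos_of_pos_of_lt_pi (by linarith) hlt
  have h4 : 0 < √b * Real.sin (b-a) := mul_pos (Real.sqrt_pos.2 hb) h3
  have h5 : 0 < σ * besselJ0 b := by
    by_contra hn
    push Not at hn
    nlinarith
  have h6 := (J1_deriv b).const_mul σ
  rw [hG] at h6
  obtain ⟨x, hx, hx2⟩ := left_neg hab h6 (by simpa using h5) (by simp [h1])
  exact absurd (hz x hx) (not_lt.2 hx2.le)

lemma gap (a b : ℝ) (ha : 0 ≤ a) (hab : a < b) (h0 : besselJ1 a = 0) (h1 : besselJ1 b = 0)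
    (hz : ∀ x ∈ Set.Ioo a b, besselJ1 x ≠ 0) : Real.pi ≤ b - a := by
  have hp : IsPreconnected (Set.Ioo a b) := isPreconnected_Ioo
  have key : (∀ x ∈ Set.Ioo a b, 0 < besselJ1 x) ∨ (∀ x ∈ Set.Ioo a b, besselJ1 x < 0) := by
    by_contra hc
    push Not at hc
    obtain ⟨⟨x, hx, hx1⟩, ⟨y, hy, hy1⟩⟩ := hc
    obtain ⟨w, hw, hw1⟩ := hp.intermediate_value hx hy J1_cont.continuousOn ⟨hx1, hy1⟩
    exact hz w hw hw1
  rcases key with h | h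
  · exact gap_aux 1 a b ha hab h0 h1 (fun x hx => by simpa using h x hx)
  · exact gap_aux (-1) a b ha hab h0 h1 (fun x hx => by simpa using h x hx)

lemma zero_ge (j : ℕ → ℝ)
    (hjpos : ∀ i, 1 ≤ i → 0 < j i)
    (hjzero : ∀ i, 1 ≤ i → besselJ1 (j i) = 0)
    (hjmono : ∀ i k, 1 ≤ i → i < k → j i < j k)
    (hjall : ∀ x : ℝ, 0 < x → besselJ1 x = 0 → ∃ i, 1 ≤ i ∧ x = j i)
    (n : ℕ) : (n+1 : ℝ) * Real.pi ≤ j (n+1) := by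
  have hle : ∀ i k, 1 ≤ i → i ≤ k → j i ≤ j k := by
    intro i k hi hk
    rcases hk.lt_or_eq with h | h
    · exact (hjmono i k hi h).le
    · rw [h]
  induction n with
  | zero =>
    have := gap 0 (j 1) le_rfl (hjpos 1 le_rfl) (by simp [J1_eq]) (hjzero 1 le_rfl) (by
      intro x hx hx0
      obtain ⟨i, hi, rfl⟩ := hjall x hx.1 hx0
      exact absurd hx.2 (not_lt.2 (hle 1 i le_rfl hi)))
    simpa using this
  | succ n ih =>
    have := gap (j (n+1)) (j (n+1+1)) (hjpos _ (by omega)).le (hjmono _ _ (by omega) (by omega))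
      (hjzero _ (by omega)) (hjzero _ (by omega)) (by
      intro x hx hx0
      obtain ⟨i, hi, rfl⟩ := hjall x ((hjpos _ (by omega)).trans hx.1) hx0
      rcases Nat.lt_or_ge i (n+2) with h | h
      · exact absurd hx.1 (not_lt.2 (hle i (n+1) hi (by omega)))
      · exact absurd hx.2 (not_lt.2 (hle (n+2) i (by omega) h)))
    push_cast
    linarith

lemma E_deriv (x : ℝ) (hx : 0 < x) : HasDerivAt (fun x : ℝ =>
    x * (besselJ0 x ^ 2 + besselJ1 x ^ 2) - besselJ0 x * besselJ1 x - besselJ1 x ^ 2 / (2*x))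
    (3 * besselJ1 x ^ 2 / (2 * x^2)) x := by
  have h0 := J0_deriv x
  have h1 := J1_deriv x
  have h2 : HasDerivAt (fun x : ℝ => 2 * x) 2 x := by simpa using (hasDerivAt_id x).const_mul 2
  have := (((hasDerivAt_id x).mul ((h0.pow 2).add (h1.pow 2))).sub (h0.mul h1)).sub
    ((h1.pow 2).div h2 (by positivity))
  refine this.congr_deriv ?_
  have hG : gB 1 (x^2/4) = 2 * besselJ1 x / x := by rw [J1_eq]; field_simp
  rw [hG]
  simp
  field_simp
  ring

lemma S_lower (c x : ℝ) (hc : 0 < c) (h1 : besselJ1 c = 0) (hx : c ≤ x) :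
    c * besselJ0 c ^ 2 ≤ (x + 1/2) * (besselJ0 x ^ 2 + besselJ1 x ^ 2) := by
  have hm : MonotoneOn (fun x : ℝ =>
    x * (besselJ0 x ^ 2 + besselJ1 x ^ 2) - besselJ0 x * besselJ1 x - besselJ1 x ^ 2 / (2*x)) (Set.Ici c) := by
    apply monotoneOn_of_deriv_nonneg (convex_Ici c)
    · intro y hy
      exact (E_deriv y (hc.trans_le hy)).continuousAt.continuousWithinAt
    · intro y hy
      rw [interior_Ici] at hy
      exact (E_deriv y (hc.trans hy)).differentiableAt.differentiableWithinAt
    · intro y hy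
      rw [interior_Ici] at hy
      rw [(E_deriv y (hc.trans hy)).deriv]
      positivity
  have := hm (Set.self_mem_Ici) hx hx
  simp only [h1, ne_eq, OfNat.ofNat_ne_zero, not_false_eq_true, zero_pow, mul_zero, zero_div, sub_zero, add_zero] at this
  have h2 : 0 ≤ besselJ1 x ^ 2 / (2*x) := by have := hc.trans_le hx; positivity
  nlinarith [sq_nonneg (besselJ0 x + besselJ1 x)]

lemma S_le_one (x : ℝ) (hx : 0 ≤ x) : besselJ0 x ^ 2 + besselJ1 x ^ 2 ≤ 1 := by
  have hd : ∀ y : ℝ, HasDerivAt (fun x => besselJ0 x ^ 2 + besselJ1 x ^ 2) (- (besselJ1 y * gB 1 (y^2/4))) y := by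
    intro y
    refine (((J0_deriv y).pow 2).add ((J1_deriv y).pow 2)).congr_deriv ?_
    simp; ring
  have hm : AntitoneOn (fun x => besselJ0 x ^ 2 + besselJ1 x ^ 2) (Set.Ici 0) := by
    apply antitoneOn_of_deriv_nonpos (convex_Ici 0)
    · intro y hy
      exact (hd y).continuousAt.continuousWithinAt
    · intro y hy
      exact (hd y).differentiableAt.differentiableWithinAt
    · intro y hy
      rw [interior_Ici] at hy
      rw [(hd y).deriv, J1_eq]
      have : 0 < y := hy
      have : 0 ≤ y / 2 * (gB 1 (y^2/4))^2 := by positivity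
      linarith
  have := hm (Set.self_mem_Ici) hx hx
  have h0 : gB 0 0 = 1 := by
    unfold gB
    rw [tsum_eq_single 0]
    · simp
    · intro k hk; simp [hk]
  simpa [J1_eq, J0_eq, h0] using this

open MeasureTheory


lemma mom_int (n : ℕ) (s : ℝ) (hs : 0 < s) :
    ∫ x in Set.Ioi (0:ℝ), x^(2*n+1) * Real.exp (-s * x^2) = n.factorial / (2 * s^(n+1)) := by
  have h := integral_rpow_mul_exp_neg_mul_rpow (p := 2) (q := ((2*n+1 : ℕ):ℝ)) (b := s) (by norm_num)
    (by have : (0:ℝ) ≤ ((2*n+1 : ℕ):ℝ) := Nat.cast_nonneg _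
        linarith) hs
  simp only [Real.rpow_natCast] at h
  have e2 : ∀ x : ℝ, x ^ (2:ℝ) = x^2 := fun x => by exact_mod_cast Real.rpow_natCast x 2
  simp only [e2] at h
  rw [h]
  have e3 : ((((2*n+1 : ℕ):ℝ)) + 1)/2 = (n:ℝ) + 1 := by push_cast; ring
  rw [neg_div, e3, Real.Gamma_nat_eq_factorial, Real.rpow_neg hs.le,
    show (n:ℝ)+1 = ((n+1 : ℕ):ℝ) by push_cast; rfl, Real.rpow_natCast]
  field_simp

lemma mom_integrable (n : ℕ) (s : ℝ) (hs : 0 < s) :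
    Integrable (fun x : ℝ => x^(2*n+1) * Real.exp (-s * x^2)) (volume.restrict (Set.Ioi 0)) := by
  have := integrable_rpow_mul_exp_neg_mul_sq hs (s := ((2*n+1 : ℕ):ℝ))
    (by have : (0:ℝ) ≤ ((2*n+1 : ℕ):ℝ) := Nat.cast_nonneg _
        linarith)
  simp only [Real.rpow_natCast] at this
  exact this.integrableOn

lemma cos_mom (n : ℕ) : ∫ x in (0:ℝ)..Real.pi, Real.cos x ^ (2*n) = Real.pi * n.centralBinom / 4^n := by
  induction n with
  | zero => simp
  | succ n ih =>
    rw [show 2*(n+1) = 2*n+2 by ring, integral_cos_pow, ih]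
    have := Nat.succ_mul_centralBinom_succ n
    have e : ((n:ℝ)+1) * (n+1).centralBinom = 2*(2*n+1) * n.centralBinom := by exact_mod_cast this
    have e2 : ((n+1).centralBinom : ℝ) = 2*(2*n+1) * n.centralBinom / (n+1) := by
      field_simp; linarith
    rw [e2]
    simp
    field_simp
    ring

lemma cos_mom2 (n : ℕ) : ∫ x in (0:ℝ)..Real.pi, Real.cos x ^ (2*n) * Real.sin x ^ 2
    = Real.pi / 2 * ((n.centralBinom : ℝ) / (n+1)) / 4^n := by
  have h : ∀ x : ℝ, Real.cos x ^ (2*n) * Real.sin x ^ 2 = Real.cos x ^ (2*n) - Real.cos x ^ (2*(n+1)) := by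
    intro x; rw [Real.sin_sq]; ring
  simp only [h]
  rw [intervalIntegral.integral_sub, cos_mom, cos_mom]
  · have := Nat.succ_mul_centralBinom_succ n
    have e : ((n:ℝ)+1) * (n+1).centralBinom = 2*(2*n+1) * n.centralBinom := by exact_mod_cast this
    have e2 : ((n+1).centralBinom : ℝ) = 2*(2*n+1) * n.centralBinom / (n+1) := by
      field_simp; linarith
    rw [e2]
    field_simp
    ring
  · exact (by fun_prop : Continuous fun x : ℝ => Real.cos x ^ (2*n)).intervalIntegrable _ _
  · exact (by fun_prop : Continuous fun x : ℝ => Real.cos x ^ (2*(n+1))).intervalIntegrable _ _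

lemma coef_le (n : ℕ) : ((n.centralBinom : ℝ) / (n+1)) / 4^n ≤ 1 := by
  have h1 : (n.centralBinom : ℝ) ≤ 4^n := by
    have := Nat.choose_le_two_pow (2*n) n
    rw [pow_mul] at this
    exact_mod_cast this
  rw [div_le_one (by positivity)]
  exact (div_le_self (by positivity) (by linarith [Nat.cast_nonneg (α := ℝ) n])).trans h1

lemma A_sum (s : ℝ) (hs : 0 < s) : HasSum (fun n : ℕ =>
      (-1)^n * (((n.centralBinom : ℝ) / (n+1)) / 4^n) / n.factorial / s^(n+1))
    (∫ x in Set.Ioi (0:ℝ), 2 * x * Real.exp (-s * x^2) * (besselJ0 x ^ 2 + besselJ1 x ^ 2)) := by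
  have hF : ∀ n : ℕ, Integrable (fun x : ℝ => (2 * ((-1)^n * (((n.centralBinom : ℝ) / (n+1)) / 4^n) / (n.factorial:ℝ)^2)) *
      (x^(2*n+1) * Real.exp (-s * x^2))) (volume.restrict (Set.Ioi 0)) := fun n =>
    (mom_integrable n s hs).const_mul _
  have key := hasSum_integral_of_summable_integral_norm hF (by
    have hb := (Real.summable_pow_div_factorial (1/s)).mul_left (1/s)
    refine Summable.of_nonneg_of_le (fun n => integral_nonneg fun _ => norm_nonneg _) ?_ hb
    intro n
    have : ∫ x in Set.Ioi (0:ℝ), ‖(2 * ((-1)^n * (((n.centralBinom : ℝ) / (n+1)) / 4^n) / (n.factorial:ℝ)^2)) *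
      (x^(2*n+1) * Real.exp (-s * x^2))‖ = ∫ x in Set.Ioi (0:ℝ), (2 * ((((n.centralBinom : ℝ) / (n+1)) / 4^n) / (n.factorial:ℝ)^2)) *
      (x^(2*n+1) * Real.exp (-s * x^2)) := by
      refine setIntegral_congr_fun measurableSet_Ioi ?_
      intro x hx
      have hx' : 0 < x := hx
      simp only [norm_mul, norm_div, norm_pow, norm_neg, norm_one, one_pow, one_mul, Real.norm_eq_abs, Real.abs_exp, Nat.abs_cast, abs_of_pos hx']
      rw [abs_of_pos (a := (n:ℝ)+1) (by positivity)]
      norm_num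
    rw [this, integral_const_mul, mom_int n s hs]
    have hc := coef_le n
    calc _ = ((((n.centralBinom : ℝ) / (n+1)) / 4^n)) * (1/s * ((1/s)^n / n.factorial)) := by
          rw [div_pow, one_pow]; field_simp; ring
      _ ≤ 1 * (1/s * ((1/s)^n / n.factorial)) := by gcongr
      _ = _ := one_mul _)
  have e1 : (fun n : ℕ =>
      (-1)^n * (((n.centralBinom : ℝ) / (n+1)) / 4^n) / n.factorial / s^(n+1)) = fun n : ℕ =>
      ∫ x in Set.Ioi (0:ℝ), (2 * ((-1)^n * (((n.centralBinom : ℝ) / (n+1)) / 4^n) / (n.factorial:ℝ)^2)) *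
      (x^(2*n+1) * Real.exp (-s * x^2)) := by
    funext n
    rw [integral_const_mul, mom_int n s hs]
    field_simp
  rw [e1]
  convert key using 1
  · rfl
  · refine setIntegral_congr_fun measurableSet_Ioi ?_
    intro x hx
    have h := (S_sum (x^2/4)).mul_left (2 * x * Real.exp (-s * x^2))
    simp only
    rw [show besselJ0 x ^ 2 + besselJ1 x ^ 2 = gB 0 (x^2/4) ^2 + x^2/4 * gB 1 (x^2/4)^2 by
      rw [J0_eq, J1_eq]; ring, ← h.tsum_eq]
    refine tsum_congr fun n => ?_
    rw [neg_pow (x^2/4), div_pow, ← pow_mul, pow_succ]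
    field_simp
    ring

lemma A_eq (s : ℝ) (hs : 0 < s) :
    ∫ x in Set.Ioi (0:ℝ), 2 * x * Real.exp (-s * x^2) * (besselJ0 x ^ 2 + besselJ1 x ^ 2) =
    2 / (Real.pi * s) * ∫ t in (0:ℝ)..Real.pi, Real.exp (-(1/s) * Real.cos t ^ 2) * Real.sin t ^ 2 := by
  have h : HasSum (fun n : ℕ => ∫ t in (0:ℝ)..Real.pi, ((-(1/s))^n / n.factorial) * (Real.cos t ^ (2*n) * Real.sin t ^ 2))
      (∫ t in (0:ℝ)..Real.pi, Real.exp (-(1/s) * Real.cos t ^ 2) * Real.sin t ^ 2) := by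
    apply intervalIntegral.hasSum_integral_of_dominated_convergence (fun n _ => (1/s)^n / n.factorial)
    · intro n
      exact (by fun_prop : Continuous fun t : ℝ => ((-(1/s))^n / n.factorial) * (Real.cos t ^ (2*n) * Real.sin t ^ 2)).aestronglyMeasurable
    · intro n
      refine Filter.Eventually.of_forall fun t _ => ?_
      rw [norm_mul, norm_div, norm_pow, norm_neg, norm_mul, norm_pow, norm_pow]
      simp only [Real.norm_eq_abs, Nat.abs_cast, abs_of_pos (one_div_pos.2 hs)]
      have h1 : |Real.cos t| ^ (2*n) ≤ 1 := pow_le_one₀ (abs_nonneg _) (Real.abs_cos_le_one t)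
      have h2 : |Real.sin t| ^ 2 ≤ 1 := pow_le_one₀ (abs_nonneg _) (Real.abs_sin_le_one t)
      exact mul_le_of_le_one_right (by positivity) (mul_le_one₀ h1 (by positivity) h2)
    · exact Filter.Eventually.of_forall fun t _ => Real.summable_pow_div_factorial _
    · exact intervalIntegrable_const
    · refine Filter.Eventually.of_forall fun t _ => ?_
      have := (NormedSpace.expSeries_div_hasSum_exp (-(1/s) * Real.cos t ^ 2)).mul_right (Real.sin t ^ 2)
      rw [← Real.exp_eq_exp_ℝ] at this
      refine this.congr_fun ?_
      intro n
      rw [mul_pow, ← pow_mul]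
      ring
  have h2 := h.mul_left (2 / (Real.pi * s))
  refine (A_sum s hs).unique (h2.congr_fun ?_)
  intro n
  rw [intervalIntegral.integral_const_mul, cos_mom2, neg_pow (1/s), div_pow, one_pow, pow_succ]
  have := Real.pi_pos
  field_simp

lemma A_le (s : ℝ) (hs : 0 < s) :
    ∫ x in Set.Ioi (0:ℝ), 2 * x * Real.exp (-s * x^2) * (besselJ0 x ^ 2 + besselJ1 x ^ 2) ≤
    2 / (Real.pi * s) * √(Real.pi * s) := by
  rw [A_eq s hs]
  have hpi := Real.pi_pos
  apply mul_le_mul_of_nonneg_left _ (by positivity)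
  have h1 : ∫ t in (0:ℝ)..Real.pi, Real.exp (-(1/s) * Real.cos t ^ 2) * Real.sin t ^ 2 ≤
      ∫ t in (0:ℝ)..Real.pi, Real.exp (-(1/s) * Real.cos t ^ 2) * Real.sin t := by
    apply intervalIntegral.integral_mono_on hpi.le
    · exact (by fun_prop : Continuous fun t : ℝ => Real.exp (-(1/s) * Real.cos t ^ 2) * Real.sin t ^ 2).intervalIntegrable _ _
    · exact (by fun_prop : Continuous fun t : ℝ => Real.exp (-(1/s) * Real.cos t ^ 2) * Real.sin t).intervalIntegrable _ _
    · intro t ht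
      have h0 := Real.sin_nonneg_of_mem_Icc ht
      have h2 := Real.sin_le_one t
      apply mul_le_mul_of_nonneg_left _ (Real.exp_pos _).le
      nlinarith
  refine h1.trans ?_
  have h2 := intervalIntegral.integral_comp_mul_deriv (a := 0) (b := Real.pi) (f := Real.cos)
    (f' := fun t => -Real.sin t) (g := fun y => Real.exp (-(1/s) * y^2))
    (fun t _ => Real.hasDerivAt_cos t) (by fun_prop) (by fun_prop)
  simp only [Function.comp_def, mul_neg, intervalIntegral.integral_neg, Real.cos_zero, Real.cos_pi] at h2
  rw [intervalIntegral.integral_symm (-1) 1, neg_inj] at h2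
  rw [h2, intervalIntegral.integral_of_le (by norm_num)]
  have h3 := integral_gaussian (1/s)
  rw [div_div_eq_mul_div, div_one] at h3
  rw [← h3]
  exact setIntegral_le_integral (integrable_exp_neg_mul_sq (one_div_pos.2 hs))
    (Filter.Eventually.of_forall fun x => (Real.exp_pos _).le)

lemma lower_int (M K N : ℝ) (hN : 0 < N) (hK : 0 ≤ K)
    (h : ∀ x : ℝ, 0 < x → M - K * Real.exp (-x^2) ≤ x * (besselJ0 x ^ 2 + besselJ1 x ^ 2)) :
    (M - 2 / Real.pi) * N ≤ K := by
  have hpi := Real.pi_pos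
  have hs : 0 < 1 / N^2 := by positivity
  set s := 1 / N^2 with hsdef
  have hi1 : IntegrableOn (fun x : ℝ => Real.exp (-s * x^2)) (Set.Ioi 0) :=
    (integrable_exp_neg_mul_sq hs).integrableOn
  have hi2 : IntegrableOn (fun x : ℝ => Real.exp (-(s+1) * x^2)) (Set.Ioi 0) :=
    (integrable_exp_neg_mul_sq (by linarith)).integrableOn
  have hi3 : IntegrableOn (fun x : ℝ => 2 * x * Real.exp (-s * x^2) * (besselJ0 x ^ 2 + besselJ1 x ^ 2)) (Set.Ioi 0) := by
    have hm := ((mom_integrable 0 s hs).const_mul 2)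
    refine Integrable.mono' hm ?_ ?_
    · have := J1_cont
      have := J0_cont
      exact (by fun_prop : Continuous fun x : ℝ => 2 * x * Real.exp (-s * x^2) * (besselJ0 x ^ 2 + besselJ1 x ^ 2)).aestronglyMeasurable
    · refine (ae_restrict_iff' measurableSet_Ioi).2 (Filter.Eventually.of_forall fun x hx => ?_)
      have hx' : 0 < x := hx
      have h1 := S_le_one x hx'.le
      rw [Real.norm_of_nonneg (by positivity)]
      have : 0 ≤ 2 * x * Real.exp (-s * x^2) := by positivity
      calc _ ≤ 2 * x * Real.exp (-s * x^2) * 1 := mul_le_mul_of_nonneg_left h1 this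
        _ = _ := by simp; ring
  have h1 : ∫ x in Set.Ioi (0:ℝ), ((2 * M) * Real.exp (-s * x^2) - (2 * K) * Real.exp (-(s+1) * x^2)) ≤
      ∫ x in Set.Ioi (0:ℝ), 2 * x * Real.exp (-s * x^2) * (besselJ0 x ^ 2 + besselJ1 x ^ 2) := by
    refine setIntegral_mono_on ((hi1.const_mul _).sub (hi2.const_mul _)) hi3 measurableSet_Ioi ?_
    intro x hx
    have e : Real.exp (-(s+1) * x^2) = Real.exp (-s * x^2) * Real.exp (-x^2) := by
      rw [← Real.exp_add]; ring_nf
    rw [e]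
    have := mul_le_mul_of_nonneg_left (h x hx) (Real.exp_pos (-s * x^2)).le
    nlinarith
  rw [integral_sub (hi1.const_mul _) (hi2.const_mul _), integral_const_mul, integral_const_mul,
    integral_gaussian_Ioi, integral_gaussian_Ioi] at h1
  have h2 := h1.trans (A_le s hs)
  have e1 : √(Real.pi / s) = √Real.pi * N := by
    rw [hsdef, div_div_eq_mul_div, div_one, Real.sqrt_mul hpi.le, Real.sqrt_sq hN.le]
  have e2 : √(Real.pi * s) = √Real.pi / N := by
    rw [hsdef, mul_one_div, Real.sqrt_div hpi.le, Real.sqrt_sq hN.le]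
  have e3 : √(Real.pi / (s+1)) ≤ √Real.pi := by
    apply Real.sqrt_le_sqrt
    exact div_le_self hpi.le (by linarith)
  have e4 : 2 / (Real.pi * s) * (√Real.pi / N) = 2 / Real.pi * (√Real.pi * N) := by
    rw [hsdef]; field_simp
  rw [e1, e2, e4] at h2
  have h5 := mul_le_mul_of_nonneg_left e3 hK
  have hsq : 0 < √Real.pi := Real.sqrt_pos.2 hpi
  have : √Real.pi * ((M - 2/Real.pi) * N) ≤ √Real.pi * K := by linarith
  exact le_of_mul_le_mul_left this hsq

lemma key_bound (c : ℝ) (hc : 0 < c) (h1 : besselJ1 c = 0) : c * besselJ0 c ^ 2 ≤ 2 / Real.pi := by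
  by_contra hn
  push Not at hn
  have hpi := Real.pi_pos
  set L := c * besselJ0 c ^ 2 with hL
  set M := (L + 2 / Real.pi) / 2 with hM
  have hp2 : 0 < 2 / Real.pi := by positivity
  have hM0 : 0 < M := by linarith
  have hML : 0 < L - M := by linarith
  have hMp : 0 < M - 2 / Real.pi := by linarith
  set X := max c (M / (2 * (L - M))) with hX
  have hX0 : 0 < X := lt_max_of_lt_left hc
  set K := M * Real.exp (X^2) with hKd
  have hK : 0 < K := by positivity
  have hall : ∀ x : ℝ, 0 < x → M - K * Real.exp (-x^2) ≤ x * (besselJ0 x ^ 2 + besselJ1 x ^ 2) := by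
    intro x hx
    rcases le_total X x with h | h
    · have hcx : c ≤ x := (le_max_left _ _).trans h
      have h2 : M / (2 * (L - M)) ≤ x := (le_max_right _ _).trans h
      rw [div_le_iff₀ (by positivity)] at h2
      have h3 := S_lower c x hc h1 hcx
      rw [← hL] at h3
      have h4 : M ≤ x * (besselJ0 x ^ 2 + besselJ1 x ^ 2) := by
        have h5 : M * (x + 1/2) ≤ x * (besselJ0 x ^ 2 + besselJ1 x ^ 2) * (x + 1/2) := by
          have := mul_le_mul_of_nonneg_left h3 hx.le
          nlinarith
        exact le_of_mul_le_mul_right h5 (by positivity)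
      have : 0 < K * Real.exp (-x^2) := by positivity
      linarith
    · have h2 : 1 ≤ Real.exp (X^2) * Real.exp (-x^2) := by
        rw [← Real.exp_add]
        apply Real.one_le_exp
        nlinarith
      have h3 : M ≤ K * Real.exp (-x^2) := by
        rw [hKd, mul_assoc]
        exact le_mul_of_one_le_right hM0.le h2
      have : 0 ≤ x * (besselJ0 x ^ 2 + besselJ1 x ^ 2) := by positivity
      linarith
  have h6 := lower_int M K ((K + 1) / (M - 2 / Real.pi)) (by positivity) hK.le hall
  rw [mul_div_cancel₀ _ hMp.ne'] at h6
  linarith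

/-- $|J_0(j_{2i-1})| ≤ √(2/(π²(2i-1)))$, where $j_k$ is the $k$-th smallest
positive zero of $J_1$. -/
theorem besselJ0_at_zero_le
    (j : ℕ → ℝ)
    (hjpos : ∀ i, 1 ≤ i → 0 < j i)
    (hjzero : ∀ i, 1 ≤ i → besselJ1 (j i) = 0)
    (hjmono : ∀ i k, 1 ≤ i → i < k → j i < j k)
    (hjall : ∀ x : ℝ, 0 < x → besselJ1 x = 0 → ∃ i, 1 ≤ i ∧ x = j i)
    (i : ℕ) (hi : 1 ≤ i) :
    |besselJ0 (j (2 * i - 1))| ≤ Real.sqrt (2 / (Real.pi ^ 2 * (2 * (i : ℝ) - 1))) := by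
  apply Real.abs_le_sqrt
  have hpi := Real.pi_pos
  obtain ⟨n, rfl⟩ : ∃ n, i = n + 1 := ⟨i - 1, by omega⟩
  have h1 := zero_ge j hjpos hjzero hjmono hjall (2*n)
  rw [show 2 * (n+1) - 1 = 2*n+1 by omega]
  have h2 := key_bound _ (hjpos (2*n+1) (by omega)) (hjzero (2*n+1) (by omega))
  push_cast at h1 ⊢
  rw [show 2 * ((n:ℝ)+1) - 1 = 2*n+1 by ring, le_div_iff₀ (by positivity)]
  rw [le_div_iff₀ hpi] at h2
  have h3 : 0 ≤ Real.pi * besselJ0 (j (2*n+1)) ^ 2 := by positivity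
  have := mul_le_mul_of_nonneg_left h1 h3
  nlinarith
end
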